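/- There exist constants κ > 0 and λ > 0 such that for every real d ≥ 1 and every N, every Ising instance on N variables whose graph has average vertex degree at most d has at most 2^{N·(1 − κ·log₂(λ·d)/d)} local minima. -/

import Mathlib

open Finset

/-- An assignment gives each variable the value `-1` or `1`. -/
def IsAssignment {N : ℕ} (S : Fin N → ℝ) : Prop := ∀ i, S i = -1 ∨ S i = 1

/-- Energy of an Ising instance: `H(S) = ∑ i, h i * S i + ∑_{i<j} J i j * S i * S j`. -/
noncomputable def energy {N : ℕ} (h : Fin N → ℝ) (J : Fin N → Fin N → ℝ)
    (S : Fin N → ℝ) : ℝ :=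
  ∑ i, h i * S i + ∑ i, ∑ j, if i < j then J i j * S i * S j else 0

/-- The assignment obtained from `S` by flipping the spin at `i`. -/
noncomputable def flipAt {N : ℕ} (S : Fin N → ℝ) (i : Fin N) : Fin N → ℝ :=
  Function.update S i (-(S i))

/-- A local minimum: flipping any single variable strictly increases the energy. -/
def IsingLocalMin {N : ℕ} (h : Fin N → ℝ) (J : Fin N → Fin N → ℝ) (S : Fin N → ℝ) : Prop :=
  IsAssignment S ∧ ∀ i, energy h J S < energy h J (flipAt S i)

/-- A global minimum: minimal energy among all assignments. -/
def IsingGlobalMin {N : ℕ} (h : Fin N → ℝ) (J : Fin N → Fin N → ℝ) (S : Fin N → ℝ) : Prop :=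
  IsAssignment S ∧ ∀ S', IsAssignment S' → energy h J S ≤ energy h J S'

/-- Degree of variable `i` in the graph of the instance: the number of `j ≠ i` with `J i j ≠ 0`. -/
noncomputable def degreeJ {N : ℕ} (J : Fin N → Fin N → ℝ) (i : Fin N) : ℕ :=
  Set.ncard {j | j ≠ i ∧ J i j ≠ 0}

theorem prod_rpow_inv_le_one_add {ι : Type*} (T : Finset ι) {k : ℕ} (hk : 0 < k) (x : ι → ℝ)
    (hx : ∀ i, 0 < x i) (hT : #{i ∈ T | x i ≠ 1} ≤ k) :
    ∏ i ∈ T, x i ^ (1 / (k : ℝ)) ≤ 1 + (1 / (k : ℝ)) * ∑ i ∈ T, (x i - 1) := by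
  have hk' : (0 : ℝ) < k := by exact_mod_cast hk
  set A := T.filter (fun i => x i ≠ 1) with hA
  have h1 : ∏ i ∈ T, x i ^ (1 / (k : ℝ)) = ∏ i ∈ A, x i ^ (1 / (k : ℝ)) := by
    refine (prod_filter_of_ne ?_).symm
    intro i _ hi h
    exact hi (by rw [h, Real.one_rpow])
  have h2 : ∑ i ∈ T, (x i - 1) = ∑ i ∈ A, (x i - 1) := by
    refine (sum_filter_of_ne ?_).symm
    intro i _ hi h
    exact hi (by rw [h, sub_self])
  rw [h1, h2]
  rcases Nat.eq_zero_or_pos #A with h0 | h0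
  · rw [card_eq_zero] at h0
    simp [h0]
  have hm : (0 : ℝ) < #A := by exact_mod_cast h0
  have hmk : (#A : ℝ) ≤ k := by exact_mod_cast hT
  have hamgm := Real.geom_mean_le_arith_mean_weighted A (fun _ => 1 / (#A : ℝ)) x
    (fun _ _ => by positivity) (by simp [hm.ne']) (fun i _ => (hx i).le)
  have hy : ∑ i ∈ A, 1 / (#A : ℝ) * x i = 1 + 1 / (#A : ℝ) * ∑ i ∈ A, (x i - 1) := by
    rw [← mul_sum, sum_sub_distrib]
    simp only [sum_const, nsmul_eq_mul, mul_one]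
    field_simp
    ring
  have hP : (0 : ℝ) ≤ ∏ i ∈ A, x i ^ (1 / (#A : ℝ)) :=
    prod_nonneg fun i _ => (Real.rpow_pos_of_pos (hx i) _).le
  calc ∏ i ∈ A, x i ^ (1 / (k : ℝ))
      = (∏ i ∈ A, x i ^ (1 / (#A : ℝ))) ^ ((#A : ℝ) / k) := by
        rw [← Real.finsetProd_rpow _ _ fun i _ => (Real.rpow_pos_of_pos (hx i) _).le]
        refine prod_congr rfl fun i _ => ?_
        rw [← Real.rpow_mul (hx i).le]
        congr 1
        field_simp
    _ ≤ (1 + 1 / (#A : ℝ) * ∑ i ∈ A, (x i - 1)) ^ ((#A : ℝ) / k) := by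
        rw [← hy]
        exact Real.rpow_le_rpow hP hamgm (by positivity)
    _ ≤ 1 + ((#A : ℝ) / k) * (1 / (#A : ℝ) * ∑ i ∈ A, (x i - 1)) := by
        refine rpow_one_add_le_one_add_mul_self ?_ (by positivity)
          ((div_le_one hk').2 hmk)
        have := hP.trans hamgm
        rw [hy] at this
        linarith
    _ = 1 + (1 / (k : ℝ)) * ∑ i ∈ A, (x i - 1) := by
        field_simp

theorem prod_rpow_add_prod_rpow_le {ι : Type*} (T : Finset ι) {k : ℕ} (hk : 0 < k) (a b : ι → ℝ)
    (ha : ∀ i, 0 < a i) (hb : ∀ i, 0 < b i) (hT : #{i ∈ T | a i ≠ b i} ≤ k) :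
    ∏ i ∈ T, a i ^ (1 / (k : ℝ)) + ∏ i ∈ T, b i ^ (1 / (k : ℝ)) ≤
      2 * ∏ i ∈ T, ((a i + b i) / 2) ^ (1 / (k : ℝ)) := by
  have hc : ∀ i, 0 < (a i + b i) / 2 := fun i => by linarith [ha i, hb i]
  have key : ∀ u : ι → ℝ, (∀ i, 0 < u i) → (∀ i, a i = b i → u i = a i) →
      ∏ i ∈ T, u i ^ (1 / (k : ℝ)) ≤ (∏ i ∈ T, ((a i + b i) / 2) ^ (1 / (k : ℝ))) *
        (1 + (1 / (k : ℝ)) * ∑ i ∈ T, (u i / ((a i + b i) / 2) - 1)) := by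
    intro u hu hab
    have h1 : ∏ i ∈ T, u i ^ (1 / (k : ℝ)) = (∏ i ∈ T, ((a i + b i) / 2) ^ (1 / (k : ℝ))) *
        ∏ i ∈ T, (u i / ((a i + b i) / 2)) ^ (1 / (k : ℝ)) := by
      rw [← prod_mul_distrib]
      refine prod_congr rfl fun i _ => ?_
      rw [← Real.mul_rpow (hc i).le (div_pos (hu i) (hc i)).le, mul_div_cancel₀ _ (hc i).ne']
    rw [h1]
    refine mul_le_mul_of_nonneg_left (prod_rpow_inv_le_one_add T hk _
      (fun i => div_pos (hu i) (hc i)) ?_) (prod_nonneg fun i _ => (Real.rpow_pos_of_pos (hc i) _).le)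
    refine (card_le_card ?_).trans hT
    intro i
    simp only [mem_filter]
    rintro ⟨hi, h⟩
    refine ⟨hi, fun he => h ?_⟩
    rw [hab i he, ← he, add_self_div_two, div_self (ha i).ne']
  have h1 := key a ha fun _ _ => rfl
  have h2 := key b hb fun _ h => h.symm
  have h3 : ∑ i ∈ T, (a i / ((a i + b i) / 2) - 1) + ∑ i ∈ T, (b i / ((a i + b i) / 2) - 1) = 0 := by
    rw [← sum_add_distrib]
    refine sum_eq_zero fun i _ => ?_
    have := (hc i).ne'
    have : a i + b i ≠ 0 := by linarith [ha i, hb i]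
    field_simp
    ring
  refine (add_le_add h1 h2).trans (le_of_eq ?_)
  rw [← mul_add, mul_comm]
  congr 1
  linear_combination (1 / (k : ℝ)) * h3

theorem sum_fin_succ_bool {n : ℕ} (F : (Fin (n + 1) → Bool) → ℝ) :
    ∑ s, F s = ∑ s : Fin n → Bool, (F (Fin.cons true s) + F (Fin.cons false s)) := by
  rw [← (Fin.consEquiv fun _ => Bool).sum_comp, Fintype.sum_prod_type, Fintype.sum_bool,
    ← sum_add_distrib]
  rfl

theorem sum_prod_rpow_le_fin {ι : Type*} (T : Finset ι) {k : ℕ} (hk : 0 < k) (n : ℕ) :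
    ∀ (f : ι → (Fin n → Bool) → ℝ) (D : ι → Finset (Fin n)), (∀ i s, 0 < f i s) →
    (∀ i, DependsOn (f i) (D i : Set (Fin n))) → (∀ v, #{i ∈ T | v ∈ D i} ≤ k) →
    ∑ s, ∏ i ∈ T, f i s ^ (1 / (k : ℝ)) ≤
      2 ^ n * ∏ i ∈ T, ((∑ s, f i s) / 2 ^ n) ^ (1 / (k : ℝ)) := by
  induction n with
  | zero => intro f D hf hD hk; simp
  | succ n ih =>
    intro f D hf hD hk'
    have hstep := ih (fun i s => (f i (Fin.cons true s) + f i (Fin.cons false s)) / 2)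
      (fun i => {v | v.succ ∈ D i})
      (fun i s => by have := hf i (Fin.cons true s); have := hf i (Fin.cons false s); positivity)
      (by
        intro i s s' hs
        have : ∀ b : Bool, f i (Fin.cons b s) = f i (Fin.cons b s') := by
          intro b
          apply hD i
          intro v hv
          cases v using Fin.cases with
          | zero => rfl
          | succ v => simpa using hs v (by simpa using hv)
        simp only [this])
      (by intro v; simpa using hk' v.succ)
    have hmean : ∀ i, (∑ s : Fin n → Bool, (f i (Fin.cons true s) + f i (Fin.cons false s)) / 2) /
        2 ^ n = (∑ s, f i s) / (2 * 2 ^ n) := by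
      intro i
      rw [sum_fin_succ_bool, ← sum_div, div_div]
    simp only [hmean] at hstep
    rw [sum_fin_succ_bool, pow_succ', mul_assoc]
    refine le_trans ?_ (mul_le_mul_of_nonneg_left hstep zero_le_two)
    rw [mul_sum]
    refine sum_le_sum fun s _ => ?_
    refine prod_rpow_add_prod_rpow_le T hk _ _ (fun i => hf i _) (fun i => hf i _) ?_
    refine (card_le_card ?_).trans (hk' 0)
    intro i
    simp only [mem_filter]
    rintro ⟨hi, h⟩
    refine ⟨hi, by_contra fun h0 => h ?_⟩
    apply hD i
    intro v hv
    cases v using Fin.cases with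
    | zero => exact absurd hv h0
    | succ v => rfl

/-- Finner's inequality on the discrete cube: if every coordinate is relevant to at most `k` of the
positive functions `f i`, the mean of the product of their `k`-th roots is at most the product of
the `k`-th roots of their means. -/
theorem sum_prod_rpow_le {ι V : Type*} [Fintype V] [DecidableEq V] (T : Finset ι) {k : ℕ}
    (hk : 0 < k) (f : ι → (V → Bool) → ℝ) (D : ι → Finset V) (hf : ∀ i s, 0 < f i s)
    (hD : ∀ i, DependsOn (f i) (D i : Set V)) (hT : ∀ v, #{i ∈ T | v ∈ D i} ≤ k) :
    ∑ s, ∏ i ∈ T, f i s ^ (1 / (k : ℝ)) ≤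
      2 ^ Fintype.card V * ∏ i ∈ T, ((∑ s, f i s) / 2 ^ Fintype.card V) ^ (1 / (k : ℝ)) := by
  let e := Fintype.equivFin V
  have hsum : ∀ F : (V → Bool) → ℝ, ∑ s : Fin (Fintype.card V) → Bool, F (s ∘ e) = ∑ s, F s :=
    fun F => (e.symm.arrowCongr (Equiv.refl Bool)).sum_comp F
  have := sum_prod_rpow_le_fin T hk (Fintype.card V) (fun i s => f i (s ∘ e))
    (fun i => (D i).map e.toEmbedding) (fun i s => hf i _)
    (by
      intro i s s' hs
      apply hD i
      intro v hv
      exact hs (e v) (by simpa using hv))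
    (by
      intro v
      refine le_trans (card_le_card ?_) (hT (e.symm v))
      intro i
      simp only [mem_filter, mem_map_equiv]
      exact id)
  simpa only [hsum, hsum (fun s => ∏ i ∈ T, f i s ^ (1 / (k : ℝ)))] using this

/-- The value `1` or `-1` of a spin. -/
def spin (b : Bool) : ℝ := if b then 1 else -1

theorem centralBinom_sq_mul_le (n : ℕ) :
    Nat.centralBinom n ^ 2 * (2 * n + 1) ≤ 16 ^ n := by
  induction n with
  | zero => simp
  | succ n ih =>
    have h := Nat.succ_mul_centralBinom_succ n
    have h2 : 0 < (n + 1) ^ 2 := by positivity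
    refine Nat.le_of_mul_le_mul_left ?_ h2
    calc (n + 1) ^ 2 * ((n + 1).centralBinom ^ 2 * (2 * (n + 1) + 1))
        = ((n + 1) * (n + 1).centralBinom) ^ 2 * (2 * n + 3) := by ring
      _ = (n.centralBinom ^ 2 * (2 * n + 1)) * (4 * (2 * n + 1) * (2 * n + 3)) := by rw [h]; ring
      _ ≤ 16 ^ n * (16 * (n + 1) ^ 2) := by
        refine Nat.mul_le_mul ih ?_
        nlinarith
      _ = (n + 1) ^ 2 * 16 ^ (n + 1) := by ring

/-- The Littlewood–Offord bound for a half-open interval, by Sperner's theorem. -/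
theorem card_sum_mem_Ico_le {U : Type*} [Fintype U] [DecidableEq U] (a : U → ℝ) {b : ℝ}
    (ha : ∀ j, b ≤ |a j|) (x : ℝ) :
    #{t : U → Bool | ∑ j, a j * spin (t j) ∈ Set.Ico x (x + 2 * b)} ≤
      (Fintype.card U).choose (Fintype.card U / 2) := by
  classical
  let φ : (U → Bool) → Finset U := fun t => {j | t j = decide (0 < a j)}
  have hφ : Function.Injective φ := by
    intro t t' h
    funext j
    have := Finset.ext_iff.1 h j
    simp only [φ, mem_filter, mem_univ, true_and] at this
    revert this
    cases t j <;> cases t' j <;> cases decide (0 < a j) <;> simp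
  have hsum : ∀ t, ∑ j, a j * spin (t j) = ∑ j, (if j ∈ φ t then |a j| else -|a j|) := by
    intro t
    refine sum_congr rfl fun j _ => ?_
    simp only [φ, mem_filter, mem_univ, true_and]
    by_cases h : 0 < a j
    · cases htj : t j <;> simp [h, spin, abs_of_pos h]
    · cases htj : t j <;> simp [h, spin, abs_of_nonpos (not_lt.1 h)]
  rw [← card_image_of_injective _ hφ]
  apply IsAntichain.sperner
  intro A hA B hB hne hsub
  simp only [coe_image, Set.mem_image, coe_filter, mem_univ, true_and, Set.mem_ofPred_eq,
    Set.mem_Ico] at hA hB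
  obtain ⟨t, ht, rfl⟩ := hA
  obtain ⟨t', ht', rfl⟩ := hB
  rw [hsum] at ht ht'
  obtain ⟨j, hj, hj'⟩ := exists_of_ssubset (hsub.ssubset_of_ne hne)
  have hdiff : 2 * b ≤ ∑ i, ((if i ∈ φ t' then |a i| else -|a i|) -
      (if i ∈ φ t then |a i| else -|a i|)) := by
    have hnn : ∀ i ∈ univ, 0 ≤ ((if i ∈ φ t' then |a i| else -|a i|) -
        (if i ∈ φ t then |a i| else -|a i|)) := by
      intro i _
      have := abs_nonneg (a i)
      by_cases h1 : i ∈ φ t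
      · simp [h1, hsub h1]
      · by_cases h2 : i ∈ φ t' <;> simp only [h1, h2, if_true, if_false] <;> linarith
    refine le_trans ?_ (single_le_sum hnn (mem_univ j))
    simp only [hj, hj', if_true, if_false]
    linarith [ha j]
  rw [sum_sub_distrib] at hdiff
  linarith [ht.1, ht'.2]

theorem card_abs_sum_lt_le {U : Type*} [Fintype U] [DecidableEq U] (a : U → ℝ) {b : ℝ}
    (hb : 0 < b) (ha : ∀ j, b ≤ |a j|) (c : ℝ) (k : ℕ) :
    #{t : U → Bool | |c + ∑ j, a j * spin (t j)| < k * b} ≤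
      k * (Fintype.card U).choose (Fintype.card U / 2) := by
  classical
  have hsub : ({t : U → Bool | |c + ∑ j, a j * spin (t j)| < k * b} : Finset _) ⊆
      (range k).biUnion fun m => {t : U → Bool | ∑ j, a j * spin (t j) ∈
        Set.Ico (-c - k * b + 2 * b * m) (-c - k * b + 2 * b * m + 2 * b)} := by
    intro t
    simp only [mem_filter, mem_univ, true_and, mem_biUnion, mem_range, Set.mem_Ico]
    intro h
    rw [abs_lt] at h
    set y := (c + ∑ j, a j * spin (t j) + k * b) / (2 * b) with hy
    have hy' : c + ∑ j, a j * spin (t j) + k * b = 2 * b * y := by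
      rw [hy]; field_simp
    have hy0 : 0 ≤ y := div_nonneg (by linarith) (by linarith)
    have hyk : y < k := by
      rw [hy, div_lt_iff₀ (by linarith)]
      linarith
    have h1 := Nat.floor_le hy0
    have h2 := Nat.lt_floor_add_one y
    refine ⟨⌊y⌋₊, (Nat.floor_lt hy0).2 hyk, ?_, ?_⟩
    · nlinarith
    · nlinarith
  refine (card_le_card hsub).trans ((card_biUnion_le_card_mul _ _ _ fun m _ =>
    card_sum_mem_Ico_le a ha _).trans ?_)
  rw [card_range]

/-- The Littlewood–Offord bound with further coordinates of arbitrary weight. -/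
theorem card_abs_sum_lt_mul_two_pow_le {V : Type*} [Fintype V] [DecidableEq V] (a : V → ℝ)
    (U : Finset V) {b : ℝ} (hb : 0 < b) (ha : ∀ j ∈ U, b ≤ |a j|) (c : ℝ) (k : ℕ) :
    #{s : V → Bool | |c + ∑ j, a j * spin (s j)| < k * b} * 2 ^ #U ≤
      2 ^ Fintype.card V * (k * (#U).choose (#U / 2)) := by
  classical
  let e := Equiv.piEquivPiSubtypeProd (fun j => j ∈ U) (fun _ => Bool)
  have hU : Fintype.card {j // j ∈ U} = #U := Fintype.card_coe U
  have h1 : #{s : V → Bool | |c + ∑ j, a j * spin (s j)| < k * b} ≤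
      2 ^ Fintype.card {j // ¬ j ∈ U} * (k * (#U).choose (#U / 2)) := by
    have hinj : #{s : V → Bool | |c + ∑ j, a j * spin (s j)| < k * b} ≤
        #((univ : Finset ({j // ¬ j ∈ U} → Bool)).sigma fun τ =>
          ({t : {j // j ∈ U} → Bool | |(c + ∑ j : {j // ¬ j ∈ U}, a j * spin (τ j)) +
            ∑ j : {j // j ∈ U}, a j * spin (t j)| < k * b} : Finset _)) := by
      refine card_le_card_of_injOn (fun s => ⟨(e s).2, (e s).1⟩) ?_ ?_
      · intro s hs
        simp only [coe_filter, mem_univ, true_and, Set.mem_ofPred_eq] at hs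
        simp only [coe_sigma, Set.mem_sigma_iff, coe_univ, Set.mem_univ, true_and, coe_filter,
          mem_univ, Set.mem_ofPred_eq]
        convert hs using 2
        rw [← Fintype.sum_subtype_add_sum_subtype (fun j => j ∈ U) fun j => a j * spin (s j)]
        simp only [e, Equiv.piEquivPiSubtypeProd_apply]
        rw [add_assoc, add_comm (∑ j : {j // ¬ j ∈ U}, _)]
        congr!
      · intro s _ s' _ h
        simp only [Sigma.mk.injEq, heq_eq_eq] at h
        exact e.injective (Prod.ext h.2 h.1)
    refine hinj.trans ?_
    rw [card_sigma]
    refine (sum_le_card_nsmul _ _ (k * (#U).choose (#U / 2)) fun τ _ => ?_).trans_eq ?_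
    · have := card_abs_sum_lt_le (fun j : {j // j ∈ U} => a j) hb (fun j => ha j j.2)
        (c + ∑ j : {j // ¬ j ∈ U}, a j * spin (τ j)) k
      rwa [hU] at this
    · simp
  have h2 : Fintype.card {j // ¬ j ∈ U} + #U = Fintype.card V := by
    rw [← hU, add_comm]
    have h3 := Fintype.card_subtype_compl (fun j => j ∈ U)
    have h4 := Fintype.card_subtype_le (fun j => j ∈ U)
    lia
  calc _ ≤ (2 ^ Fintype.card {j // ¬ j ∈ U} * (k * (#U).choose (#U / 2))) * 2 ^ #U :=
        Nat.mul_le_mul_right _ h1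
    _ = _ := by rw [← h2, pow_add]; ring

/-- Deletion method: a random set of density `q`, minus a point of each forbidden set in it. -/
theorem exists_card_ge_and_forall_not_subset {V : Type*} [Fintype V] [DecidableEq V]
    (F : Finset (Finset V)) (hF : ∀ B ∈ F, B.Nonempty) {q : ℝ} (hq0 : 0 ≤ q) (hq1 : q ≤ 1) :
    ∃ T : Finset V, Fintype.card V * q - ∑ B ∈ F, q ^ #B ≤ #T ∧ ∀ B ∈ F, ¬ B ⊆ T := by
  classical
  let w : Finset V → ℝ := fun T => (∏ _v ∈ T, q) * ∏ _v ∈ Tᶜ, (1 - q)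
  have hw0 : ∀ T, 0 ≤ w T := fun T =>
    mul_nonneg (prod_nonneg fun _ _ => hq0) (prod_nonneg fun _ _ => sub_nonneg.2 hq1)
  have hw : ∀ B : Finset V, ∑ T, w T * (if B ⊆ T then 1 else 0) = q ^ #B := by
    intro B
    have h := Fintype.prod_add (fun _ : V => q) (fun v => if v ∈ B then 0 else 1 - q)
    have h1 : ∀ v : V, q + (if v ∈ B then 0 else 1 - q) = if v ∈ B then q else 1 := by
      intro v; split_ifs <;> ring
    simp only [h1, prod_ite_mem, univ_inter, prod_const] at h
    rw [h]
    refine sum_congr rfl fun T _ => ?_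
    by_cases hBT : B ⊆ T
    · simp only [w, hBT, if_true, mul_one, prod_const]
      congr 1
      rw [← prod_const]
      refine prod_congr rfl fun v hv => ?_
      rw [if_neg fun hvB => mem_compl.1 hv (hBT hvB)]
    · obtain ⟨v, hvB, hvT⟩ := not_subset.1 hBT
      have h0 : ∏ v ∈ Tᶜ, (if v ∈ B then 0 else 1 - q) = 0 :=
        Finset.prod_eq_zero (mem_compl.2 hvT) (by rw [if_pos hvB])
      rw [if_neg hBT, h0, mul_zero, mul_zero]
  have hw1 : ∑ T, w T = 1 := by simpa using hw ∅
  have hcard : ∑ T, w T * (#T : ℝ) = Fintype.card V * q := by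
    have : ∀ T : Finset V, (#T : ℝ) = ∑ v, if {v} ⊆ T then (1 : ℝ) else 0 := by
      intro T; simp
    simp only [this, mul_sum]
    rw [sum_comm]
    simp only [hw, card_singleton, pow_one, sum_const, card_univ, nsmul_eq_mul]
  have hbad : ∑ T, w T * (#{B ∈ F | B ⊆ T} : ℝ) = ∑ B ∈ F, q ^ #B := by
    have : ∀ T : Finset V, (#{B ∈ F | B ⊆ T} : ℝ) = ∑ B ∈ F, if B ⊆ T then (1 : ℝ) else 0 := by
      intro T; simp
    simp only [this, mul_sum]
    rw [sum_comm]
    exact sum_congr rfl fun B _ => hw B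
  obtain ⟨T', hT'⟩ : ∃ T : Finset V,
      Fintype.card V * q - ∑ B ∈ F, q ^ #B ≤ (#T : ℝ) - #{B ∈ F | B ⊆ T} := by
    by_contra! hlt
    have h1 : ∑ T, w T * ((#T : ℝ) - #{B ∈ F | B ⊆ T}) <
        ∑ T, w T * (Fintype.card V * q - ∑ B ∈ F, q ^ #B) := by
      refine sum_lt_sum (fun T _ => mul_le_mul_of_nonneg_left (hlt T).le (hw0 T)) ?_
      obtain ⟨T, -, hT⟩ := exists_ne_zero_of_sum_ne_zero (hw1.symm ▸ one_ne_zero :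
        ∑ T, w T ≠ 0)
      exact ⟨T, mem_univ _, mul_lt_mul_of_pos_left (hlt T) ((hw0 T).lt_of_ne' hT)⟩
    rw [← sum_mul, hw1, one_mul] at h1
    simp only [mul_sub, sum_sub_distrib, hcard, hbad] at h1
    exact lt_irrefl _ h1
  let pick : Finset V → Finset V := fun B => if h : B.Nonempty then {h.choose} else ∅
  refine ⟨T' \ ({B ∈ F | B ⊆ T'} : Finset _).biUnion pick, hT'.trans ?_, ?_⟩
  · have h1 : #(({B ∈ F | B ⊆ T'} : Finset _).biUnion pick) ≤ #{B ∈ F | B ⊆ T'} * 1 := by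
      refine card_biUnion_le_card_mul _ _ _ fun B _ => ?_
      simp only [pick]
      split_ifs <;> simp
    have h2 := le_card_sdiff (({B ∈ F | B ⊆ T'} : Finset _).biUnion pick) T'
    have h3 : #T' ≤ #(T' \ ({B ∈ F | B ⊆ T'} : Finset _).biUnion pick) + #{B ∈ F | B ⊆ T'} := by
      lia
    have h4 : (#T' : ℝ) ≤ #(T' \ ({B ∈ F | B ⊆ T'} : Finset _).biUnion pick) +
        #{B ∈ F | B ⊆ T'} := by exact_mod_cast h3
    linarith
  · intro B hB hsub
    have hne := hF B hB
    have h1 := mem_sdiff.1 (hsub hne.choose_spec)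
    refine h1.2 (mem_biUnion.2 ⟨B, ?_, ?_⟩)
    · exact mem_filter.2 ⟨hB, hsub.trans sdiff_subset⟩
    · simp [pick, hne]

theorem exists_subset_card_eq_forall_le {V : Type*} [DecidableEq V] (w : V → ℝ) (A : Finset V)
    (r : ℕ) (hr : r ≤ #A) : ∃ U ⊆ A, #U = r ∧ ∀ j ∈ U, ∀ l ∈ A \ U, w l ≤ w j := by
  induction r with
  | zero => exact ⟨∅, by simp⟩
  | succ r ih =>
    obtain ⟨U, hUA, hU, hmax⟩ := ih (by lia)
    have hne : (A \ U).Nonempty := by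
      rw [← card_pos, card_sdiff_of_subset hUA]
      lia
    obtain ⟨m, hm, hm'⟩ := exists_max_image (A \ U) w hne
    have hm1 := mem_sdiff.1 hm
    refine ⟨insert m U, insert_subset hm1.1 hUA, by rw [card_insert_of_notMem hm1.2, hU], ?_⟩
    intro j hj l hl
    have hl' : l ∈ A \ U := by
      rw [mem_sdiff, mem_insert, not_or] at hl
      exact mem_sdiff.2 ⟨hl.1, hl.2.2⟩
    rcases mem_insert.1 hj with rfl | hj
    · exact hm' l hl'
    · exact hmax j hj l hl'

/-- The neighbours of `i` in the graph of the couplings `J`. -/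
noncomputable def couplingNbrs {V : Type*} [Fintype V] (J : V → V → ℝ) (i : V) : Finset V :=
  {j | J i j ≠ 0}

theorem exists_sparse_set {V : Type*} [Fintype V] [DecidableEq V] (J : V → V → ℝ)
    (hdiag : ∀ i, J i i = 0) {D r k : ℕ} (hD : ∀ i, #(couplingNbrs J i) ≤ D)
    (top : V → Finset V) (htop : ∀ i, top i ⊆ couplingNbrs J i) (hr : ∀ i, #(top i) ≤ r)
    {q : ℝ} (hq0 : 0 ≤ q) (hq1 : q ≤ 1) :
    ∃ T : Finset V,
      Fintype.card V * q * (1 - r * q - D.choose (k + 1) * q ^ k) ≤ #T ∧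
      (∀ i ∈ T, ∀ j ∈ top i, j ∉ T) ∧ ∀ v, #(couplingNbrs J v ∩ T) ≤ k := by
  classical
  let F₁ : Finset (Finset V) := univ.biUnion fun i => (top i).image fun j => {i, j}
  let F₂ : Finset (Finset V) := univ.biUnion fun v => (couplingNbrs J v).powersetCard (k + 1)
  have hF₁ : ∀ B ∈ F₁, #B = 2 := by
    intro B hB
    simp only [F₁, mem_biUnion, mem_univ, true_and, mem_image] at hB
    obtain ⟨i, j, hj, rfl⟩ := hB
    refine card_pair ?_
    rintro rfl
    exact (mem_filter.1 (htop i hj)).2 (hdiag i)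
  have hF₂ : ∀ B ∈ F₂, #B = k + 1 := by
    intro B hB
    simp only [F₂, mem_biUnion, mem_univ, true_and, mem_powersetCard] at hB
    obtain ⟨v, -, hB⟩ := hB
    exact hB
  have hc₁ : #F₁ ≤ Fintype.card V * r :=
    card_biUnion_le_card_mul _ _ _ fun i _ => card_image_le.trans (hr i)
  have hc₂ : #F₂ ≤ Fintype.card V * D.choose (k + 1) := by
    refine card_biUnion_le_card_mul _ _ _ fun i _ => ?_
    rw [card_powersetCard]
    exact Nat.choose_le_choose _ (hD i)
  obtain ⟨T, hT, hFT⟩ := exists_card_ge_and_forall_not_subset (F₁ ∪ F₂) (by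
    intro B hB
    rw [← card_pos]
    rcases mem_union.1 hB with h | h
    · rw [hF₁ B h]; lia
    · rw [hF₂ B h]; lia) hq0 hq1
  refine ⟨T, le_trans ?_ hT, ?_, ?_⟩
  · have h1 : ∑ B ∈ F₁, q ^ #B ≤ Fintype.card V * r * q ^ 2 := by
      rw [sum_congr rfl fun B hB => by rw [hF₁ B hB], sum_const, nsmul_eq_mul]
      have : (#F₁ : ℝ) ≤ Fintype.card V * r := by exact_mod_cast hc₁
      gcongr
    have h2 : ∑ B ∈ F₂, q ^ #B ≤ Fintype.card V * D.choose (k + 1) * q ^ (k + 1) := by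
      rw [sum_congr rfl fun B hB => by rw [hF₂ B hB], sum_const, nsmul_eq_mul]
      have : (#F₂ : ℝ) ≤ Fintype.card V * D.choose (k + 1) := by exact_mod_cast hc₂
      gcongr
    have h3 : ∑ B ∈ F₁ ∪ F₂, q ^ #B ≤ ∑ B ∈ F₁, q ^ #B + ∑ B ∈ F₂, q ^ #B := by
      rw [← sum_union_inter]
      exact le_add_of_nonneg_right (sum_nonneg fun _ _ => by positivity)
    have h4 : Fintype.card V * q * (1 - r * q - D.choose (k + 1) * q ^ k) = Fintype.card V * q -
      (Fintype.card V * r * q ^ 2 + Fintype.card V * D.choose (k + 1) * q ^ (k + 1)) := by ring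
    linarith
  · intro i hi j hj hjT
    refine hFT {i, j} (mem_union_left _ ?_) (insert_subset hi (singleton_subset_iff.2 hjT))
    exact mem_biUnion.2 ⟨i, mem_univ _, mem_image_of_mem _ hj⟩
  · intro v
    by_contra! hlt
    obtain ⟨B, hB, hcard⟩ := exists_subset_card_eq (Nat.succ_le_of_lt hlt)
    refine hFT B (mem_union_right _ ?_) (hB.trans inter_subset_right)
    exact mem_biUnion.2 ⟨v, mem_univ _, mem_powersetCard.2 ⟨hB.trans inter_subset_left, hcard⟩⟩

/-- Every spin is strictly anti-aligned with its local field. -/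
def IsStable {V : Type*} [Fintype V] (h : V → ℝ) (J : V → V → ℝ) (s : V → Bool) : Prop :=
  ∀ i, spin (s i) * (h i + ∑ j, J i j * spin (s j)) < 0

/-- The part of the local field at `i` that comes from outside `T`. -/
noncomputable def outerField {V : Type*} [Fintype V] [DecidableEq V] (h : V → ℝ) (J : V → V → ℝ)
    (T : Finset V) (i : V) (s : V → Bool) : ℝ :=
  h i + ∑ j, (if j ∈ T then 0 else J i j) * spin (s j)

/-- The spins in `T` whose sign in a stable configuration may depend on the spins in `T`. -/
noncomputable def undetermined {V : Type*} [Fintype V] [DecidableEq V] (h : V → ℝ) (J : V → V → ℝ)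
    (T : Finset V) (s : V → Bool) : Finset V :=
  {i ∈ T | |outerField h J T i s| < ∑ j ∈ T, |J i j|}

theorem outerField_congr {V : Type*} [Fintype V] [DecidableEq V] (h : V → ℝ) (J : V → V → ℝ)
    (T : Finset V) (i : V) {s s' : V → Bool} (hs : ∀ j, J i j ≠ 0 → j ∉ T → s j = s' j) :
    outerField h J T i s = outerField h J T i s' := by
  unfold outerField
  congr 1
  refine sum_congr rfl fun j _ => ?_
  by_cases hj : j ∈ T
  · simp [hj]
  · by_cases hJ : J i j = 0
    · simp [hJ]
    · rw [hs j hJ hj]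

theorem abs_field_sub_outerField_le {V : Type*} [Fintype V] [DecidableEq V] (h : V → ℝ)
    (J : V → V → ℝ) (T : Finset V) (i : V) (s : V → Bool) :
    |(h i + ∑ j, J i j * spin (s j)) - outerField h J T i s| ≤ ∑ j ∈ T, |J i j| := by
  have : (h i + ∑ j, J i j * spin (s j)) - outerField h J T i s =
      ∑ j ∈ T, J i j * spin (s j) := by
    unfold outerField
    rw [add_sub_add_left_eq_sub, ← sum_sub_distrib, ← sum_filter_add_sum_filter_not univ (· ∈ T)]
    rw [sum_eq_zero (s := {x | x ∉ T}), add_zero]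
    · rw [filter_mem_eq_inter, univ_inter]
      exact sum_congr rfl fun j hj => by simp [hj]
    · intro j hj
      simp [(mem_filter.1 hj).2]
  rw [this]
  refine (abs_sum_le_sum_abs _ _).trans (sum_le_sum fun j _ => ?_)
  rw [abs_mul]
  cases s j <;> simp [spin]

theorem IsStable.eq_of_notMem_undetermined {V : Type*} [Fintype V] [DecidableEq V] {h : V → ℝ}
    {J : V → V → ℝ} {T : Finset V} {s s' : V → Bool} (hs : IsStable h J s) (hs' : IsStable h J s')
    (hss' : ∀ j ∉ T, s j = s' j) {i : V} (hi : i ∈ T) (hu : i ∉ undetermined h J T s) :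
    s i = s' i := by
  have h1 := abs_field_sub_outerField_le h J T i s
  have h2 := abs_field_sub_outerField_le h J T i s'
  rw [← outerField_congr h J T i fun j _ hj => hss' j hj] at h2
  have h3 := hs i
  have h4 := hs' i
  simp only [undetermined, mem_filter, hi, true_and, not_lt] at hu
  rw [abs_le] at h1 h2
  generalize h i + ∑ j, J i j * spin (s j) = x at h1 h3
  generalize h i + ∑ j, J i j * spin (s' j) = y at h2 h4
  rcases abs_cases (outerField h J T i s) with ⟨h5, h6⟩ | ⟨h5, h6⟩ <;> rw [h5] at hu <;>
    revert h3 h4 <;> cases s i <;> cases s' i <;> simp [spin] <;> intros <;> linarith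

theorem card_isStable_mul_two_pow_le {V : Type*} [Fintype V] [DecidableEq V] (h : V → ℝ)
    (J : V → V → ℝ) (T : Finset V) [DecidablePred (IsStable h J)] :
    #{s | IsStable h J s} * 2 ^ #T ≤ ∑ s, 2 ^ #(undetermined h J T s) := by
  classical
  have hcongr : ∀ {s s' : V → Bool}, (∀ j ∉ T, s j = s' j) →
      undetermined h J T s = undetermined h J T s' := by
    intro s s' hs
    unfold undetermined
    refine filter_congr fun i _ => ?_
    rw [outerField_congr h J T i fun j _ hj => hs j hj]
  have key : #(({s | IsStable h J s} : Finset (V → Bool)) ×ˢ T.powerset) ≤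
      #((univ : Finset (V → Bool)).sigma fun s => (undetermined h J T s).powerset) := by
    refine card_le_card_of_injOn (fun p => ⟨fun v => if v ∈ T then decide (v ∈ p.2) else p.1 v,
      {i ∈ undetermined h J T p.1 | p.1 i = true}⟩) ?_ ?_
    · rintro ⟨s, B⟩ -
      simp only [coe_sigma, Set.mem_sigma_iff, coe_univ, Set.mem_univ, true_and, mem_coe,
        mem_powerset]
      have hs : undetermined h J T s =
          undetermined h J T fun v => if v ∈ T then decide (v ∈ B) else s v :=
        hcongr fun j hj => by simp only [hj, if_false]
      rw [← hs]
      exact filter_subset _ _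
    · rintro ⟨s, B⟩ hs ⟨s', B'⟩ hs' heq
      simp only [coe_product, Set.mem_prod, mem_coe, mem_filter, mem_univ, true_and,
        mem_powerset] at hs hs'
      simp only [Sigma.mk.injEq, heq_eq_eq] at heq
      obtain ⟨h1, h2⟩ := heq
      have hout : ∀ j ∉ T, s j = s' j := by
        intro j hj
        simpa [hj] using congrFun h1 j
      rw [← hcongr hout] at h2
      have hss : s = s' := by
        funext i
        by_cases hiT : i ∈ T
        · by_cases hu : i ∈ undetermined h J T s
          · have := Finset.ext_iff.1 h2 i
            simp only [mem_filter, hu, true_and] at this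
            exact Bool.eq_iff_iff.2 this
          · exact hs.1.eq_of_notMem_undetermined hs'.1 hout hiT hu
        · exact hout i hiT
      have hBB : B = B' := by
        ext v
        by_cases hv : v ∈ T
        · simpa [hv] using congrFun h1 v
        · exact ⟨fun h => absurd (hs.2 h) hv, fun h => absurd (hs'.2 h) hv⟩
      rw [hss, hBB]
  rw [card_product, card_powerset, card_sigma] at key
  simpa only [card_powerset] using key

theorem card_abs_outerField_lt_mul_le {V : Type*} [Fintype V] [DecidableEq V] (h : V → ℝ)
    (J : V → V → ℝ) {T : Finset V} {i : V} {k m : ℕ} {U : Finset V}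
    (hT : #(couplingNbrs J i ∩ T) ≤ k) (hU : U ⊆ couplingNbrs J i) (hUT : ∀ j ∈ U, j ∉ T)
    (hcase : U = couplingNbrs J i ∨ #U = 2 * m ∧
      ∀ j ∈ U, ∀ l ∈ couplingNbrs J i \ U, |J i l| ≤ |J i j|) (hm : 0 < m) :
    #{s | |outerField h J T i s| < ∑ j ∈ T, |J i j|} * 4 ^ m ≤
      2 ^ Fintype.card V * (k * Nat.centralBinom m) := by
  have hsum : ∑ j ∈ T, |J i j| = ∑ j ∈ couplingNbrs J i ∩ T, |J i j| := by
    refine (sum_subset inter_subset_right fun j hj hj' => ?_).symm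
    by_contra hne
    exact hj' (mem_inter.2 ⟨mem_filter.2 ⟨mem_univ _, fun h0 => hne (by rw [h0, abs_zero])⟩, hj⟩)
  rcases hcase with rfl | ⟨hcard, hmax⟩
  · have : couplingNbrs J i ∩ T = ∅ := by
      rw [← disjoint_iff_inter_eq_empty, disjoint_left]
      exact hUT
    rw [hsum, this, sum_empty, filter_false_of_mem fun s _ => (abs_nonneg _).not_gt]
    simp
  · obtain ⟨j₀, hj₀, hmin⟩ := exists_min_image U (fun j => |J i j|)
      (card_pos.1 (by lia))
    have hb : 0 < |J i j₀| := abs_pos.2 (mem_filter.1 (hU hj₀)).2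
    have hle : ∑ j ∈ T, |J i j| ≤ k * |J i j₀| := by
      rw [hsum]
      refine (sum_le_card_nsmul _ _ |J i j₀| fun l hl => ?_).trans ?_
      · refine hmax j₀ hj₀ l (mem_sdiff.2 ⟨(mem_inter.1 hl).1, fun hlU => ?_⟩)
        exact hUT l hlU (mem_inter.1 hl).2
      · rw [nsmul_eq_mul]
        gcongr
    have hLO := card_abs_sum_lt_mul_two_pow_le (fun j => if j ∈ T then 0 else J i j) U hb
      (fun j hj => by rw [if_neg (hUT j hj)]; exact hmin j hj) (h i) k
    rw [hcard, Nat.mul_div_cancel_left m two_pos, pow_mul] at hLO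
    refine le_trans (Nat.mul_le_mul_right _ (card_le_card ?_)) hLO
    intro s
    simp only [mem_filter, mem_univ, true_and]
    exact fun hs => hs.trans_le hle

theorem centralBinom_mul_le (k : ℕ) :
    Nat.centralBinom (8 * 4 ^ k) * (4 * 2 ^ k) ≤ 4 ^ (8 * 4 ^ k) := by
  rw [← Nat.pow_le_pow_iff_left (n := 2) two_ne_zero]
  calc (Nat.centralBinom (8 * 4 ^ k) * (4 * 2 ^ k)) ^ 2
      = Nat.centralBinom (8 * 4 ^ k) ^ 2 * (2 * (8 * 4 ^ k)) := by
        rw [mul_pow, mul_pow, ← pow_mul 2 k 2, mul_comm k 2, pow_mul 2 2 k]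
        ring
    _ ≤ Nat.centralBinom (8 * 4 ^ k) ^ 2 * (2 * (8 * 4 ^ k) + 1) := by gcongr; lia
    _ ≤ 16 ^ (8 * 4 ^ k) := centralBinom_sq_mul_le _
    _ = (4 ^ (8 * 4 ^ k)) ^ 2 := by rw [← pow_mul, mul_comm _ 2, pow_mul 4 2]; norm_num

theorem sum_two_pow_card_undetermined_le {V : Type*} [Fintype V] [DecidableEq V] (h : V → ℝ)
    (J : V → V → ℝ) (hJ : ∀ i j, J i j = J j i) (T : Finset V) {k : ℕ} (hk : 0 < k)
    (hT : ∀ v, #(couplingNbrs J v ∩ T) ≤ k)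
    (hp : ∀ i ∈ T, #{s | |outerField h J T i s| < ∑ j ∈ T, |J i j|} * (4 * 2 ^ k) ≤
      2 ^ Fintype.card V * k) :
    ∑ s, (2 : ℝ) ^ #(undetermined h J T s) ≤
      2 ^ Fintype.card V * (2 : ℝ) ^ ((#T : ℝ) / 2) := by
  classical
  have hk' : (0 : ℝ) < k := by exact_mod_cast hk
  let f : V → (V → Bool) → ℝ := fun i s =>
    if |outerField h J T i s| < ∑ j ∈ T, |J i j| then 2 ^ k else 1
  have hf : ∀ i s, 0 < f i s := by
    intro i s
    simp only [f]
    split_ifs <;> positivity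
  have hroot : ∀ s, (2 : ℝ) ^ #(undetermined h J T s) = ∏ i ∈ T, f i s ^ (1 / (k : ℝ)) := by
    intro s
    rw [undetermined, ← prod_const, prod_filter]
    refine prod_congr rfl fun i _ => ?_
    simp only [f]
    split_ifs
    · rw [← Real.rpow_natCast, ← Real.rpow_mul zero_le_two, mul_one_div_cancel hk'.ne',
        Real.rpow_one]
    · rw [Real.one_rpow]
  have hfinner := sum_prod_rpow_le T hk f (fun i => couplingNbrs J i \ T) hf
    (by
      intro i s s' hs
      simp only [f]
      rw [outerField_congr h J T i fun j hj hjT =>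
        hs j (mem_coe.2 (mem_sdiff.2 ⟨mem_filter.2 ⟨mem_univ _, hj⟩, hjT⟩))])
    (by
      intro v
      refine le_trans (card_le_card fun i hi => ?_) (hT v)
      simp only [mem_filter, mem_sdiff, couplingNbrs, mem_univ, true_and, mem_inter] at hi ⊢
      exact ⟨hJ v i ▸ hi.2.1, hi.1⟩)
  simp only [hroot]
  refine hfinner.trans (mul_le_mul_of_nonneg_left ?_ (by positivity))
  have hmean : ∀ i ∈ T, ((∑ s, f i s) / 2 ^ Fintype.card V) ^ (1 / (k : ℝ)) ≤
      (2 : ℝ) ^ (1 / 2 : ℝ) := by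
    intro i hi
    have h1 : ∑ s, f i s ≤ 2 ^ Fintype.card V * (1 + k / 4) := by
      have hpi : (#{s | |outerField h J T i s| < ∑ j ∈ T, |J i j|} : ℝ) * (4 * 2 ^ k) ≤
          2 ^ Fintype.card V * k := by exact_mod_cast hp i hi
      calc ∑ s, f i s
          ≤ ∑ s, (1 + if |outerField h J T i s| < ∑ j ∈ T, |J i j| then (2 : ℝ) ^ k else 0) := by
            refine sum_le_sum fun s _ => ?_
            simp only [f]
            split_ifs <;> simp
        _ = 2 ^ Fintype.card V +
            #{s | |outerField h J T i s| < ∑ j ∈ T, |J i j|} * (2 : ℝ) ^ k := by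
            rw [sum_add_distrib, ← sum_filter]
            simp
        _ ≤ 2 ^ Fintype.card V * (1 + k / 4) := by linarith
    have h2 : (∑ s, f i s) / 2 ^ Fintype.card V ≤ Real.exp (k / 4) := by
      rw [div_le_iff₀' (by positivity)]
      refine h1.trans (mul_le_mul_of_nonneg_left ?_ (by positivity))
      linarith [Real.add_one_le_exp ((k : ℝ) / 4)]
    have h3 : 0 ≤ (∑ s, f i s) / 2 ^ Fintype.card V :=
      div_nonneg (sum_nonneg fun s _ => (hf i s).le) (by positivity)
    refine (Real.rpow_le_rpow h3 h2 (by positivity)).trans ?_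
    rw [← Real.exp_mul, Real.rpow_def_of_pos two_pos, Real.exp_le_exp]
    have := Real.log_two_gt_d9
    have h4 : (k : ℝ) / 4 * (1 / k) = 1 / 4 := by field_simp
    rw [h4]
    linarith
  calc ∏ i ∈ T, ((∑ s, f i s) / 2 ^ Fintype.card V) ^ (1 / (k : ℝ))
      ≤ ∏ _i ∈ T, (2 : ℝ) ^ (1 / 2 : ℝ) := by
        refine prod_le_prod (fun i _ => ?_) hmean
        exact Real.rpow_nonneg (div_nonneg (sum_nonneg fun s _ => (hf i s).le) (by positivity)) _
    _ = (2 : ℝ) ^ ((#T : ℝ) / 2) := by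
        rw [prod_const, ← Real.rpow_natCast, ← Real.rpow_mul zero_le_two]
        congr 1
        ring

theorem choose_mul_pow_le {D : ℕ} (hD : 16 ≤ D) :
    (D.choose (Nat.log 16 D + 1) : ℝ) * (Nat.log 16 D / (4096 * D)) ^ Nat.log 16 D ≤ 1 / 4 := by
  set k := Nat.log 16 D with hk
  have hk1 : 1 ≤ k := Nat.log_pos (by norm_num) hD
  have hD0 : (0 : ℝ) < D := by
    have : 0 < D := by lia
    exact_mod_cast this
  have hDk : (D : ℝ) ≤ 16 ^ (k + 1) := by
    exact_mod_cast (Nat.lt_pow_succ_log_self (by norm_num) D).le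
  have h1 : (D.choose (k + 1) : ℝ) ≤ D ^ (k + 1) / k.factorial := by
    refine (Nat.choose_le_pow_div (k + 1) D).trans ?_
    gcongr
    exact k.le_succ
  have h2 : (k : ℝ) ^ k / k.factorial ≤ 3 ^ k := by
    refine (Real.pow_div_factorial_le_exp (k : ℝ) (by positivity) k).trans ?_
    rw [← Real.exp_one_pow]
    gcongr
    linarith [Real.exp_one_lt_d9]
  have h3 : (3 / 4096 * 16 : ℝ) ^ k ≤ (3 / 4096 * 16 : ℝ) ^ 1 :=
    pow_le_pow_of_le_one (by norm_num) (by norm_num) hk1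
  calc (D.choose (k + 1) : ℝ) * (k / (4096 * D)) ^ k
      ≤ D ^ (k + 1) / k.factorial * (k / (4096 * D)) ^ k := by gcongr
    _ = D * (k ^ k / k.factorial) / 4096 ^ k := by
        rw [div_pow, mul_pow]
        field_simp
        ring
    _ ≤ 16 ^ (k + 1) * 3 ^ k / 4096 ^ k := by gcongr
    _ = 16 * (3 / 4096 * 16 : ℝ) ^ k := by
        rw [mul_pow, div_pow]
        ring
    _ ≤ 1 / 4 := by
        rw [pow_one] at h3
        linarith

/-- The bound for instances of bounded degree. -/
theorem card_isStable_le {V : Type*} [Fintype V] [DecidableEq V] (h : V → ℝ)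
    (J : V → V → ℝ) (hJ : ∀ i j, J i j = J j i) (hdiag : ∀ i, J i i = 0)
    [DecidablePred (IsStable h J)] {D : ℕ} (hD : 16 ≤ D) (hdeg : ∀ i, #(couplingNbrs J i) ≤ D) :
    (#{s | IsStable h J s} : ℝ) ≤
      2 ^ ((Fintype.card V : ℝ) - Fintype.card V * (Nat.log 16 D / (16384 * D))) := by
  have hq := choose_mul_pow_le hD
  set k := Nat.log 16 D with hk
  have hk1 : 1 ≤ k := Nat.log_pos (by norm_num) hD
  have hD0 : (0 : ℝ) < D := by
    have : 0 < D := by lia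
    exact_mod_cast this
  have hkD : (16 : ℝ) ^ k ≤ D := by
    exact_mod_cast Nat.pow_log_le_self 16 (by lia)
  have hk4 : (k : ℝ) ≤ 4 ^ k := by
    exact_mod_cast (Nat.lt_pow_self (by norm_num)).le
  have h44 : (4 : ℝ) ^ k * 4 ^ k = 16 ^ k := by rw [← mul_pow]; norm_num
  have hkk : (k : ℝ) * 4 ^ k ≤ D := by
    refine le_trans ?_ hkD
    rw [← h44]
    gcongr
  have htop : ∀ i, ∃ U ⊆ couplingNbrs J i, #U ≤ 2 * (8 * 4 ^ k) ∧ (U = couplingNbrs J i ∨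
      #U = 2 * (8 * 4 ^ k) ∧ ∀ j ∈ U, ∀ l ∈ couplingNbrs J i \ U, |J i l| ≤ |J i j|) := by
    intro i
    rcases le_total (#(couplingNbrs J i)) (2 * (8 * 4 ^ k)) with hle | hle
    · exact ⟨_, subset_rfl, hle, Or.inl rfl⟩
    · obtain ⟨U, h1, h2, h3⟩ := exists_subset_card_eq_forall_le (fun j => |J i j|) _ _ hle
      exact ⟨U, h1, h2.le, Or.inr ⟨h2, h3⟩⟩
  choose top htop hcard hcase using htop
  have hq1 : (k : ℝ) / (4096 * D) ≤ 1 := by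
    rw [div_le_one (by positivity)]
    have : (1 : ℝ) ≤ 4 ^ k := one_le_pow₀ (by norm_num)
    nlinarith
  obtain ⟨T, hTcard, hTtop, hTk⟩ := exists_sparse_set J hdiag hdeg top htop hcard
    (q := k / (4096 * D)) (k := k) (by positivity) hq1
  have hrq : ((2 * (8 * 4 ^ k) : ℕ) : ℝ) * (k / (4096 * D)) ≤ 1 / 4 := by
    rw [mul_div_assoc', div_le_iff₀ (by positivity)]
    push_cast
    linarith
  have hT : (Fintype.card V : ℝ) * (k / (8192 * D)) ≤ #T := by
    refine le_trans ?_ hTcard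
    have h1 : (Fintype.card V : ℝ) * (k / (8192 * D)) =
        Fintype.card V * (k / (4096 * D)) * (1 / 2) := by
      field_simp
      ring
    rw [h1]
    refine mul_le_mul_of_nonneg_left ?_ (by positivity)
    linarith
  have hsum := sum_two_pow_card_undetermined_le h J hJ T (by lia : 0 < k) hTk (by
    intro i hi
    have h1 := card_abs_outerField_lt_mul_le h J (hTk i) (htop i) (hTtop i hi) (hcase i)
      (by positivity)
    refine Nat.le_of_mul_le_mul_right ?_ (by positivity : 0 < 4 ^ (8 * 4 ^ k))
    calc _ = #{s | |outerField h J T i s| < ∑ j ∈ T, |J i j|} * 4 ^ (8 * 4 ^ k) * (4 * 2 ^ k) := by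
          ring
      _ ≤ 2 ^ Fintype.card V * (k * Nat.centralBinom (8 * 4 ^ k)) * (4 * 2 ^ k) := by gcongr
      _ = 2 ^ Fintype.card V * k * (Nat.centralBinom (8 * 4 ^ k) * (4 * 2 ^ k)) := by ring
      _ ≤ 2 ^ Fintype.card V * k * 4 ^ (8 * 4 ^ k) := by
          gcongr
          exact centralBinom_mul_le k)
  have hcount : (#{s | IsStable h J s} : ℝ) * 2 ^ #T ≤ ∑ s, (2 : ℝ) ^ #(undetermined h J T s) := by
    exact_mod_cast card_isStable_mul_two_pow_le h J T
  have hfin : (#{s | IsStable h J s} : ℝ) ≤ 2 ^ ((Fintype.card V : ℝ) - #T / 2) := by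
    have h2 := hcount.trans hsum
    rw [← le_div_iff₀ (by positivity)] at h2
    refine h2.trans_eq ?_
    rw [← Real.rpow_natCast, ← Real.rpow_natCast, ← Real.rpow_add two_pos, ← Real.rpow_sub two_pos]
    congr 1
    ring
  refine hfin.trans (Real.rpow_le_rpow_of_exponent_le one_le_two ?_)
  have h1 : (Fintype.card V : ℝ) * (k / (16384 * D)) =
      Fintype.card V * (k / (8192 * D)) / 2 := by
    field_simp
    ring
  rw [h1]
  linarith

/-- Conditioning on the spins outside `p` leaves an instance on `p` with a modified field. -/
theorem card_isStable_le_of_subtype {V : Type*} [Fintype V] [DecidableEq V] (h : V → ℝ)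
    (J : V → V → ℝ) (p : V → Prop) [DecidablePred p] [DecidablePred (IsStable h J)] {M : ℝ}
    (hM : ∀ (h' : {i // p i} → ℝ) [DecidablePred (IsStable h' fun i j => J i j)],
      (#{t : {i // p i} → Bool | IsStable h' (fun i j => J i j) t} : ℝ) ≤ M) :
    (#{s | IsStable h J s} : ℝ) ≤ 2 ^ Fintype.card {i // ¬ p i} * M := by
  classical
  let e := Equiv.piEquivPiSubtypeProd p (fun _ => Bool)
  let h' : ({i // ¬ p i} → Bool) → {i // p i} → ℝ := fun τ i =>
    h i + ∑ j : {i // ¬ p i}, J i j * spin (τ j)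
  have hinj : #{s | IsStable h J s} ≤
      #((univ : Finset ({i // ¬ p i} → Bool)).sigma fun τ =>
        ({t : {i // p i} → Bool | IsStable (h' τ) (fun i j => J i j) t} : Finset _)) := by
    refine card_le_card_of_injOn (fun s => ⟨(e s).2, (e s).1⟩) ?_ ?_
    · intro s hs
      simp only [coe_filter, mem_univ, true_and, Set.mem_ofPred_eq] at hs
      simp only [coe_sigma, Set.mem_sigma_iff, coe_univ, Set.mem_univ, true_and, coe_filter,
        mem_univ, Set.mem_ofPred_eq]
      intro i
      have hsi := hs i
      rw [← Fintype.sum_subtype_add_sum_subtype p fun j => J i j * spin (s j)] at hsi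
      simp only [e, h', Equiv.piEquivPiSubtypeProd_apply]
      rw [add_assoc, add_comm (∑ j : {i // ¬ p i}, _)]
      exact hsi
    · intro s _ s' _ hss
      simp only [Sigma.mk.injEq, heq_eq_eq] at hss
      exact e.injective (Prod.ext hss.2 hss.1)
  have hinj' : (#{s | IsStable h J s} : ℝ) ≤ ∑ τ : {i // ¬ p i} → Bool,
      (#{t : {i // p i} → Bool | IsStable (h' τ) (fun i j => J i j) t} : ℝ) := by
    rw [card_sigma] at hinj
    exact_mod_cast hinj
  refine hinj'.trans ((sum_le_card_nsmul _ _ M fun τ _ => hM _).trans_eq ?_)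
  simp

theorem two_mul_sum_sum_ite_lt {N : ℕ} (J : Fin N → Fin N → ℝ) (hJ : ∀ i j, J i j = J j i)
    (hdiag : ∀ i, J i i = 0) (S : Fin N → ℝ) :
    2 * (∑ i, ∑ j, if i < j then J i j * S i * S j else 0) = ∑ i, ∑ j, J i j * S i * S j := by
  rw [two_mul]
  nth_rewrite 2 [sum_comm]
  simp only [← sum_add_distrib]
  refine sum_congr rfl fun i _ => sum_congr rfl fun j _ => ?_
  rcases lt_trichotomy i j with h | rfl | h
  · simp [h, h.not_gt]
  · simp [hdiag]
  · simp [h, h.not_gt, hJ i j]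
    ring

theorem energy_flipAt {N : ℕ} (h : Fin N → ℝ) (J : Fin N → Fin N → ℝ)
    (hJ : ∀ i j, J i j = J j i) (hdiag : ∀ i, J i i = 0) (S : Fin N → ℝ) (i : Fin N) :
    energy h J (flipAt S i) = energy h J S - 2 * (S i * (h i + ∑ j, J i j * S j)) := by
  have hflip : ∀ a, flipAt S i a = S a + (if a = i then -2 * S i else 0) := by
    intro a
    unfold flipAt
    by_cases ha : a = i
    · subst ha
      simp
      ring
    · simp [ha]
  have hlin : ∑ a, h a * flipAt S i a = ∑ a, h a * S a - 2 * (S i * h i) := by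
    simp only [hflip, mul_add, sum_add_distrib, mul_ite, mul_zero, sum_ite_eq', mem_univ, if_true]
    ring
  have hquad : ∑ a, ∑ b, J a b * flipAt S i a * flipAt S i b =
      ∑ a, ∑ b, J a b * S a * S b - 4 * (S i * ∑ j, J i j * S j) := by
    have hsymm : ∑ a, J a i * S a * (-2 * S i) = -2 * (S i * ∑ j, J i j * S j) := by
      rw [mul_sum, mul_sum]
      exact sum_congr rfl fun a _ => by rw [hJ a i]; ring
    have hrow : ∑ b, J i b * (-2 * S i) * S b = -2 * (S i * ∑ j, J i j * S j) := by
      rw [mul_sum, mul_sum]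
      exact sum_congr rfl fun a _ => by ring
    have hexp : ∀ a b, J a b * flipAt S i a * flipAt S i b = J a b * S a * S b +
        (if b = i then J a b * S a * (-2 * S i) else 0) +
        (if a = i then J a b * (-2 * S i) * S b else 0) +
        (if a = i then if b = i then J a b * (-2 * S i) * (-2 * S i) else 0 else 0) := by
      intro a b
      rw [hflip, hflip]
      split_ifs <;> ring
    have hcol : ∑ a, ∑ b, (if a = i then J a b * (-2 * S i) * S b else 0) =
        -2 * (S i * ∑ j, J i j * S j) := by
      rw [sum_comm]
      simp only [sum_ite_eq', mem_univ, if_true, hrow]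
    have hdd : ∑ a, ∑ b, (if a = i then if b = i then J a b * (-2 * S i) * (-2 * S i) else 0
        else 0) = 0 := by
      rw [sum_comm]
      simp [hdiag]
    simp only [hexp, sum_add_distrib, hcol, hdd]
    simp only [sum_ite_eq', mem_univ, if_true, hsymm]
    ring
  have h1 := two_mul_sum_sum_ite_lt J hJ hdiag S
  have h2 := two_mul_sum_sum_ite_lt J hJ hdiag (flipAt S i)
  unfold energy
  rw [hlin]
  linarith

theorem ncard_isingLocalMin_le {N : ℕ} (h : Fin N → ℝ) (J : Fin N → Fin N → ℝ)
    (hJ : ∀ i j, J i j = J j i) (hdiag : ∀ i, J i i = 0) [DecidablePred (IsStable h J)] :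
    Set.ncard {S : Fin N → ℝ | IsingLocalMin h J S} ≤ #{s | IsStable h J s} := by
  classical
  have hsub : {S : Fin N → ℝ | IsingLocalMin h J S} ⊆
      (({s | IsStable h J s} : Finset (Fin N → Bool)).image fun s i => spin (s i) : Finset _) := by
    rintro S ⟨hS, hmin⟩
    have hspin : S = fun i => spin (decide (S i = 1)) := by
      funext i
      rcases hS i with h | h <;> simp [h, spin]
    refine mem_coe.2 (mem_image.2 ⟨fun i => decide (S i = 1), ?_, hspin.symm⟩)
    refine mem_filter.2 ⟨mem_univ _, fun i => ?_⟩
    have h1 := hmin i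
    rw [energy_flipAt h J hJ hdiag] at h1
    have h2 : ∀ j, spin (decide (S j = 1)) = S j := fun j => (congrFun hspin j).symm
    simp only [h2]
    linarith
  refine (Set.ncard_le_ncard hsub (finite_toSet _)).trans ?_
  rw [Set.ncard_coe_finset]
  exact card_image_le

/-- there are `κ, λ > 0` such that every Ising instance on `N` variables whose
graph has average vertex degree at most `d` (`d ≥ 1` real) has at most
`2^{N(1 - κ·log₂(λd)/d)}` local minima. -/
theorem stmt17 :
    ∃ κ lam : ℝ, 0 < κ ∧ 0 < lam ∧
      ∀ (d : ℝ), 1 ≤ d →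
        ∀ (N : ℕ) (h : Fin N → ℝ) (J : Fin N → Fin N → ℝ),
          (∀ i j, J i j = J j i) → (∀ i, J i i = 0) →
          ((∑ i, (degreeJ J i : ℝ)) ≤ d * N) →
          (Set.ncard {S : Fin N → ℝ | IsingLocalMin h J S} : ℝ) ≤
            (2 : ℝ) ^ ((N : ℝ) * (1 - κ * Real.logb 2 (lam * d) / d)) := by
  classical
  refine ⟨1 / 2 ^ 19, 1 / 8, by positivity, by positivity, ?_⟩
  intro d hd N h J hJ hdiag havg
  have hd0 : 0 < d := by linarith
  refine le_trans (Nat.cast_le.2 (ncard_isingLocalMin_le h J hJ hdiag)) ?_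
  rcases lt_or_ge d 8 with hd8 | hd8
  · have hlog : Real.logb 2 (1 / 8 * d) ≤ 0 :=
      Real.logb_nonpos one_lt_two (by positivity) (by linarith)
    have h1 : (#{s | IsStable h J s} : ℝ) ≤ 2 ^ (N : ℝ) := by
      rw [Real.rpow_natCast]
      have := card_le_univ ({s | IsStable h J s} : Finset (Fin N → Bool))
      rw [Fintype.card_fun, Fintype.card_bool, Fintype.card_fin] at this
      exact_mod_cast this
    refine h1.trans (Real.rpow_le_rpow_of_exponent_le one_le_two ?_)
    have h2 : 1 / 2 ^ 19 * Real.logb 2 (1 / 8 * d) / d ≤ 0 :=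
      div_nonpos_of_nonpos_of_nonneg (mul_nonpos_of_nonneg_of_nonpos (by positivity) hlog) hd0.le
    exact le_mul_of_one_le_right (Nat.cast_nonneg N) (by linarith)
  have hdegree : ∀ i, degreeJ J i = #(couplingNbrs J i) := by
    intro i
    rw [degreeJ, ← Set.ncard_coe_finset]
    congr 1
    ext j
    simp only [couplingNbrs, coe_filter, mem_univ, true_and, Set.mem_ofPred_eq]
    refine ⟨fun h => h.2, fun h => ⟨?_, h⟩⟩
    rintro rfl
    exact h (hdiag _)
  let p : Fin N → Prop := fun i => (degreeJ J i : ℝ) ≤ 2 * d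
  set D := ⌊2 * d⌋₊ with hDdef
  have hD16 : 16 ≤ D := Nat.le_floor (by push_cast; linarith)
  have hDle : (D : ℝ) ≤ 2 * d := Nat.floor_le (by linarith)
  have hDlt : 2 * d < D + 1 := Nat.lt_floor_add_one _
  have hdeg : ∀ i : {i // p i}, #(couplingNbrs (fun i j : {i // p i} => J i j) i) ≤ D := by
    intro i
    refine le_trans ?_ (Nat.le_floor (hdegree i ▸ i.2 : (#(couplingNbrs J i) : ℝ) ≤ 2 * d))
    refine card_le_card_of_injOn Subtype.val (fun j hj => ?_) Subtype.val_injective.injOn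
    exact mem_coe.2 (mem_filter.2 ⟨mem_univ _, (mem_filter.1 (mem_coe.1 hj)).2⟩)
  have hcard : (Fintype.card {i // p i} : ℝ) + Fintype.card {i // ¬ p i} = N := by
    have h3 := Fintype.card_subtype_compl p
    have h4 := Fintype.card_subtype_le p
    rw [Fintype.card_fin] at h3 h4
    have : Fintype.card {i // p i} + Fintype.card {i // ¬ p i} = N := by
      rw [h3]
      exact Nat.add_sub_of_le h4
    exact_mod_cast this
  have hhigh : 2 * (Fintype.card {i // ¬ p i} : ℝ) ≤ N := by
    have h1 : (Fintype.card {i // ¬ p i} : ℝ) * (2 * d) ≤ d * N := by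
      refine le_trans ?_ havg
      rw [Fintype.card_subtype, ← nsmul_eq_mul]
      refine (card_nsmul_le_sum _ (fun i => (degreeJ J i : ℝ)) _ fun i hi => ?_).trans
        (sum_le_sum_of_subset_of_nonneg (subset_univ _) fun _ _ _ => Nat.cast_nonneg _)
      exact (not_le.1 (mem_filter.1 hi).2).le
    refine le_of_mul_le_mul_left ?_ hd0
    linarith
  have hmain := card_isStable_le_of_subtype h J p fun h' _ =>
    card_isStable_le h' (fun i j => J i j) (fun i j => hJ i j) (fun i => hdiag i) hD16 hdeg
  refine hmain.trans ?_
  rw [← Real.rpow_natCast, ← Real.rpow_add two_pos]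
  refine Real.rpow_le_rpow_of_exponent_le one_le_two ?_
  set k := Nat.log 16 D with hk
  have hk1 : (1 : ℝ) ≤ k := by exact_mod_cast Nat.log_pos (by norm_num) hD16
  have hlogk : Real.logb 2 (1 / 8 * d) ≤ 8 * k := by
    have h1 : (D : ℝ) + 1 ≤ 16 ^ (k + 1) := by
      exact_mod_cast Nat.lt_pow_succ_log_self (by norm_num) D
    have h2 : Real.logb 2 (1 / 8 * d) ≤ Real.logb 2 ((2 : ℝ) ^ (4 * (k + 1))) := by
      refine Real.logb_le_logb_of_le one_lt_two (by positivity) ?_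
      rw [pow_mul]
      norm_num only
      linarith
    rw [Real.logb_pow, Real.logb_self_eq_one one_lt_two] at h2
    push_cast at h2
    linarith
  have hlow : (N : ℝ) / 2 ≤ Fintype.card {i // p i} := by linarith
  have hgain : (N : ℝ) * (1 / 2 ^ 19 * Real.logb 2 (1 / 8 * d) / d) ≤
      Fintype.card {i // p i} * (k / (16384 * D)) := by
    have hD0 : (0 : ℝ) < D := by
      have : 0 < D := by lia
      exact_mod_cast this
    calc (N : ℝ) * (1 / 2 ^ 19 * Real.logb 2 (1 / 8 * d) / d)
        ≤ N * (1 / 2 ^ 19 * (8 * k) / d) := by gcongr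
      _ = N / 2 * (k / (16384 * (2 * d))) := by
          field_simp
          ring
      _ ≤ Fintype.card {i // p i} * (k / (16384 * D)) := by gcongr
  linarith
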